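/- arXiv:1408.0597 — 3 statements merged into one kernel-verified Lean document; each statement's English description precedes it below -/
import Mathlib

section
/- Let σ be an operator connection that is not a scalar multiple of the left-trivial mean (A,B) ↦ A, with representing function f. Given an invertible positive operator A > 0 and B ≥ 0, the operator equation A σ X = B has a positive solution X ≥ 0 if and only if the spectrum of A^{-1/2} B A^{-1/2} is contained in the range of f. In that case, the solution is unique and is given by X = A^{1/2} f^{-1}(A^{-1/2} B A^{-1/2}) A^{1/2}, where f^{-1} denotes the inverse of f on its range, applied via the continuous functional calculus. -/
open ContinuousLinearMap Filter Topology MeasureTheory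
open scoped NNReal ENNReal

set_option synthInstance.maxHeartbeats 1000000
set_option maxHeartbeats 1000000

noncomputable section

variable {H : Type} [NormedAddCommGroup H] [InnerProductSpace ℂ H] [CompleteSpace H]

/-- Convergence of a sequence of bounded operators in the strong operator topology. -/
def SOTTendsto (A : ℕ → H →L[ℂ] H) (A₀ : H →L[ℂ] H) : Prop :=
  ∀ x : H, Tendsto (fun n => A n x) atTop (𝓝 (A₀ x))

/-- A Kubo–Ando operator connection on the positive bounded operators on `H`:
a binary operation on positive operators (hence positivity of the output) satisfying
monotonicity (M1), the transformer inequality (M2) and continuity from above (M3). -/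
structure IsConnection (σ : (H →L[ℂ] H) → (H →L[ℂ] H) → (H →L[ℂ] H)) : Prop where
  isPositive : ∀ A B : H →L[ℂ] H, A.IsPositive → B.IsPositive → (σ A B).IsPositive
  mono : ∀ A B C D : H →L[ℂ] H, A.IsPositive → B.IsPositive → C.IsPositive → D.IsPositive →
    A ≤ C → B ≤ D → σ A B ≤ σ C D
  transformer : ∀ A B C : H →L[ℂ] H, A.IsPositive → B.IsPositive → C.IsPositive →
    C * σ A B * C ≤ σ (C * A * C) (C * B * C)
  contFromAbove : ∀ (A B : ℕ → H →L[ℂ] H) (A₀ B₀ : H →L[ℂ] H),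
    (∀ n, (A n).IsPositive) → (∀ n, (B n).IsPositive) → A₀.IsPositive → B₀.IsPositive →
    Antitone A → Antitone B → SOTTendsto A A₀ → SOTTendsto B B₀ →
    Antitone (fun n => σ (A n) (B n)) ∧ SOTTendsto (fun n => σ (A n) (B n)) (σ A₀ B₀)

/-- A function `f : [0,∞) → [0,∞)` is operator monotone if for every complex Hilbert
space `K` and all positive bounded operators `A ≤ B` on `K` one has `f(A) ≤ f(B)`,
where `f` is applied via the continuous functional calculus. -/
def OperatorMonotone (f : ℝ≥0 → ℝ≥0) : Prop :=
  ∀ (K : Type) [NormedAddCommGroup K] [InnerProductSpace ℂ K] [CompleteSpace K],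
    ∀ A B : K →L[ℂ] K, A.IsPositive → B.IsPositive → A ≤ B → cfc f A ≤ cfc f B

/-- `f` is the representing function of the connection `σ`: `f` is operator monotone
and `f(x)·I = I σ (x·I)` for all `x ≥ 0`. -/
def IsRepresentingFunction (σ : (H →L[ℂ] H) → (H →L[ℂ] H) → (H →L[ℂ] H))
    (f : ℝ≥0 → ℝ≥0) : Prop :=
  OperatorMonotone f ∧
    ∀ x : ℝ≥0, σ 1 ((x : ℝ) • (1 : H →L[ℂ] H)) = (f x : ℝ) • (1 : H →L[ℂ] H)

/-- The kernel `t ↦ 1 !ₜ x = x / ((1-t)x + t)`, with the conventions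
`1 !₀ x = 1` for every `x` (in particular `1 !₀ 0 = 1`) and `1 !ₜ 0 = 0` for `t > 0`. -/
def harmKernel (t : ℝ) (x : ℝ≥0) : ℝ≥0∞ :=
  if t = 0 then 1 else ENNReal.ofReal ((x : ℝ) / ((1 - t) * (x : ℝ) + t))

/-- `μ` is the associated (finite Borel) measure of a connection with representing
function `f`: `μ` is supported on `[0,1]` and `f(x) = ∫_{[0,1]} (1 !ₜ x) dμ(t)`. -/
def IsAssociatedMeasure (f : ℝ≥0 → ℝ≥0) (μ : Measure ℝ) : Prop :=
  μ (Set.Icc (0:ℝ) 1)ᶜ = 0 ∧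
    ∀ x : ℝ≥0, (f x : ℝ≥0∞) = ∫⁻ t in Set.Icc (0:ℝ) 1, harmKernel t x ∂μ

/-- `g` is the transpose of `f`: `g(x) = x·f(1/x)` for `x > 0`, extended to `0` by
continuity, i.e. `g(0) = lim_{x→0⁺} x·f(1/x)`. -/
def IsTransposeFunction (g f : ℝ≥0 → ℝ≥0) : Prop :=
  (∀ x : ℝ≥0, x ≠ 0 → g x = x * f x⁻¹) ∧
    Tendsto (fun x : ℝ≥0 => x * f x⁻¹) (𝓝[>] (0 : ℝ≥0)) (𝓝 (g 0))

section CStarAlgebra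

variable {𝓐 : Type*} [CStarAlgebra 𝓐] [PartialOrder 𝓐] [StarOrderedRing 𝓐]

lemma exists_bernstein_partition {Y : 𝓐} (hY : 0 ≤ Y) (hY1 : Y ≤ 1) (n : ℕ) :
    ∃ p : ℕ → 𝓐, (∀ i, 0 ≤ p i ∧ Commute (p i) Y) ∧
      ∑ i ∈ Finset.range (n + 1), p i = 1 ∧
      ∑ i ∈ Finset.range (n + 1), (i : ℝ) • p i = (n : ℝ) • Y ∧
      ∑ i ∈ Finset.range (n + 1), ((i : ℝ) ^ 2) • p i =
        ((n : ℝ) ^ 2) • (Y * Y) + (n : ℝ) • (Y - Y * Y) := by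
  have h1 := congrArg (Polynomial.aeval Y) (bernsteinPolynomial.sum ℝ n)
  have h2 := congrArg (Polynomial.aeval Y) (bernsteinPolynomial.sum_smul ℝ n)
  have h3 := congrArg (Polynomial.aeval Y) (bernsteinPolynomial.sum_mul_smul ℝ n)
  simp only [map_sum, map_one, map_nsmul, Polynomial.aeval_X, map_pow] at h1 h2 h3
  refine ⟨fun i => Polynomial.aeval Y (bernsteinPolynomial ℝ n i), fun i => ⟨?_, ?_⟩, h1, ?_, ?_⟩
  · have hc : Commute Y (1 - Y) := (Commute.one_right Y).sub_right (Commute.refl Y)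
    simp only [bernsteinPolynomial, map_mul, map_natCast, map_pow, map_sub, map_one,
      Polynomial.aeval_X]
    rw [mul_assoc, ← nsmul_eq_mul]
    exact nsmul_nonneg (Commute.mul_nonneg (CStarAlgebra.pow_nonneg hY _)
      (CStarAlgebra.pow_nonneg (sub_nonneg.2 hY1) _) (hc.pow_pow _ _)) _
  · simpa using (Commute.all (bernsteinPolynomial ℝ n i) Polynomial.X).map
      (Polynomial.aeval Y : Polynomial ℝ →ₐ[ℝ] 𝓐)
  · simpa only [Nat.cast_smul_eq_nsmul] using h2
  · have key : ∀ i : ℕ, ((i : ℝ) ^ 2) = ((i * (i - 1) : ℕ) : ℝ) + i := by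
      intro i
      rcases i with _ | i
      · simp
      · push_cast [Nat.add_sub_cancel]; ring
    simp only [key, add_smul, Finset.sum_add_distrib, Nat.cast_smul_eq_nsmul]
    rw [h2, h3, pow_two, nsmul_sub]
    abel

lemma commute_of_jordan_nonneg {T Y : 𝓐} (hT : IsSelfAdjoint T) (hY : 0 ≤ Y) (hY1 : Y ≤ 1)
    (h : ∀ k : 𝓐, 0 ≤ k → Commute k Y → 0 ≤ k * T + T * k) : Commute T Y := by
  set K := T * Y - Y * T with hK
  have hYs : star Y = Y := (IsSelfAdjoint.of_nonneg hY).star_eq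
  have hKs : star K = -K := by
    simp [hK, hYs, hT.star_eq]
  set ε : ℝ := 1 / (2 * (‖T‖ + 1)) with hε
  have hε0 : 0 < ε := by positivity
  have hεT : ε * ‖T‖ ≤ 1 / 2 := by
    rw [hε, div_mul_eq_mul_div, div_le_div_iff₀ (by positivity) (by positivity)]
    nlinarith [norm_nonneg T]
  set R := Y - Y * Y with hR
  have main : ∀ n : ℕ, 0 < n →
      (n * ε : ℝ) • (star K * K) ≤ R * T + T * R := by
    intro n hn
    have hn' : (0 : ℝ) < n := by exact_mod_cast hn
    obtain ⟨p, hp, s0, s1, s2⟩ := exists_bernstein_partition hY hY1 n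
    set V : 𝓐 := Y - ε • K with hV
    have hVs : star V = Y + ε • K := by
      simp [hV, hYs, hKs]
    have hpos : 0 ≤ ∑ i ∈ Finset.range (n + 1),
        star ((i : ℝ) • 1 - (n : ℝ) • V) * (p i * T + T * p i) *
          ((i : ℝ) • 1 - (n : ℝ) • V) :=
      Finset.sum_nonneg fun i _ => star_left_conjugate_nonneg (h _ (hp i).1 (hp i).2) _
    have expand : ∀ i : ℕ, star ((i : ℝ) • (1 : 𝓐) - (n : ℝ) • V) * (p i * T + T * p i) *
          ((i : ℝ) • 1 - (n : ℝ) • V) =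
        ((((i : ℝ) ^ 2) • p i) * T + T * (((i : ℝ) ^ 2) • p i))
        - (n : ℝ) • (star V * (((i : ℝ) • p i) * T + T * ((i : ℝ) • p i))
          + (((i : ℝ) • p i) * T + T * ((i : ℝ) • p i)) * V)
        + ((n : ℝ) ^ 2) • (star V * (p i * T + T * p i) * V) := by
      intro i
      simp only [star_sub, star_smul, star_one, star_trivial, sub_mul, mul_sub, smul_mul_assoc,
        mul_smul_comm, one_mul, mul_one, mul_add, add_mul, smul_add, smul_sub, smul_smul, mul_assoc]
      module
    simp only [expand, Finset.sum_add_distrib, Finset.sum_sub_distrib, ← Finset.smul_sum,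
      ← Finset.mul_sum, ← Finset.sum_mul, s0, s1, s2] at hpos
    have e2 : ((n : ℝ) ^ 2 • (Y * Y) + (n : ℝ) • (Y - Y * Y)) * T +
            T * ((n : ℝ) ^ 2 • (Y * Y) + (n : ℝ) • (Y - Y * Y)) -
          (n : ℝ) • (star V * ((n : ℝ) • Y * T + T * (n : ℝ) • Y) +
            ((n : ℝ) • Y * T + T * (n : ℝ) • Y) * V) +
        (n : ℝ) ^ 2 • (star V * (1 * T + T * 1) * V) =
        (n : ℝ) • ((R * T + T * R) - (2 * n * ε : ℝ) • (star K * K)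
          + (2 * n * ε ^ 2 : ℝ) • (star K * T * K)) := by
      rw [hVs, hKs, hV, hR, hK]
      simp only [sub_mul, mul_sub, smul_mul_assoc, neg_mul,
        mul_smul_comm, one_mul, mul_one, mul_add, add_mul, smul_add, smul_sub, smul_smul, mul_assoc]
      module
    rw [e2] at hpos
    have hpos' := smul_nonneg (inv_nonneg.2 hn'.le) hpos
    rw [inv_smul_smul₀ hn'.ne'] at hpos'
    have hKT : star K * T * K ≤ ‖T‖ • (star K * K) :=
      CStarAlgebra.star_left_conjugate_le_norm_smul hT
    have hKK : 0 ≤ star K * K := star_mul_self_nonneg K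
    have a1 : (2 * n * ε ^ 2 : ℝ) • (star K * T * K) ≤
        (n * ε : ℝ) • (star K * K) := by
      refine (smul_le_smul_of_nonneg_left hKT (by positivity)).trans ?_
      rw [smul_smul]
      refine smul_le_smul_of_nonneg_right ?_ hKK
      have : (n : ℝ) * ε * (ε * ‖T‖) ≤ n * ε * (1 / 2) :=
        mul_le_mul_of_nonneg_left hεT (by positivity)
      nlinarith
    have a2 : 0 ≤ (R * T + T * R) - (2 * n * ε : ℝ) • (star K * K) + (n * ε : ℝ) • (star K * K) :=
      hpos'.trans (by gcongr)
    rw [← sub_nonneg]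
    convert a2 using 1
    module
  have hz : ‖K‖ * ‖K‖ = 0 := by
    by_contra hne
    have hpos : 0 < ‖K‖ * ‖K‖ := lt_of_le_of_ne (by positivity) (Ne.symm hne)
    obtain ⟨n, hn⟩ := exists_nat_gt (‖R * T + T * R‖ / (ε * (‖K‖ * ‖K‖)))
    have hn0 : 0 < n := by
      have : (0 : ℝ) < n := lt_of_le_of_lt (by positivity) hn
      exact_mod_cast this
    have := CStarAlgebra.norm_le_norm_of_nonneg_of_le
      (smul_nonneg (by positivity) (star_mul_self_nonneg K)) (main n hn0)
    rw [norm_smul, CStarRing.norm_star_mul_self, Real.norm_of_nonneg (by positivity)] at this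
    rw [div_lt_iff₀ (by positivity)] at hn
    nlinarith
  have hK0 : K = 0 := by simpa using hz
  exact sub_eq_zero.1 hK0

lemma commute_of_conjugate_le {T Y : 𝓐} (hT : 0 ≤ T) (hY : 0 ≤ Y)
    (h : ∀ k : 𝓐, 0 ≤ k → k ≤ 1 → Commute k Y → k * T * k ≤ T) : Commute T Y := by
  have jordan : ∀ k : 𝓐, 0 ≤ k → Commute k Y → 0 ≤ k * T + T * k := by
    intro k hk hkY
    set ε : ℝ := (‖k‖ + 1)⁻¹ with hε
    have hε0 : 0 < ε := by positivity
    have hεk : ε • k ≤ 1 := by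
      have h1 : k ≤ (‖k‖ + 1) • (1 : 𝓐) := by
        refine (IsSelfAdjoint.of_nonneg hk).le_algebraMap_norm_self.trans ?_
        rw [Algebra.algebraMap_eq_smul_one]
        exact smul_le_smul_of_nonneg_right (by linarith) zero_le_one
      have := smul_le_smul_of_nonneg_left h1 hε0.le
      rwa [smul_smul, hε, inv_mul_cancel₀ (by positivity), one_smul] at this
    have h2 := h (1 - ε • k) (sub_nonneg.2 hεk) (by simpa using smul_nonneg hε0.le hk)
      ((Commute.one_left Y).sub_left (hkY.smul_left ε))
    have h3 : 0 ≤ k * T * k := conjugate_nonneg_of_nonneg hT hk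
    have h4 : ε • (ε • (k * T * k)) ≤ ε • (k * T + T * k) := by
      rw [← sub_nonneg] at h2 ⊢
      convert h2 using 1
      simp only [sub_mul, mul_sub, smul_mul_assoc, mul_smul_comm, one_mul, mul_one, smul_add,
        mul_assoc]
      module
    have h5 := smul_le_smul_of_nonneg_left h4 (inv_nonneg.2 hε0.le)
    rw [inv_smul_smul₀ hε0.ne', inv_smul_smul₀ hε0.ne'] at h5
    exact (smul_nonneg hε0.le h3).trans h5
  set c : ℝ := (‖Y‖ + 1)⁻¹ with hc
  have hc0 : 0 < c := by positivity
  have hcY : c • Y ≤ 1 := by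
    have h1 : Y ≤ (‖Y‖ + 1) • (1 : 𝓐) := by
      refine (IsSelfAdjoint.of_nonneg hY).le_algebraMap_norm_self.trans ?_
      rw [Algebra.algebraMap_eq_smul_one]
      exact smul_le_smul_of_nonneg_right (by linarith) zero_le_one
    have := smul_le_smul_of_nonneg_left h1 hc0.le
    rwa [smul_smul, hc, inv_mul_cancel₀ (by positivity), one_smul] at this
  have := commute_of_jordan_nonneg (IsSelfAdjoint.of_nonneg hT) (smul_nonneg hc0.le hY) hcY
    (fun k hk hkY => jordan k hk (by simpa [inv_smul_smul₀ hc0.ne'] using hkY.smul_right c⁻¹))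
  simpa [inv_smul_smul₀ hc0.ne'] using this.smul_right c⁻¹

open scoped ComplexOrder in
lemma eq_cfc_of_commute_of_bounds {T Y : 𝓐} (hT : 0 ≤ T) (hY : 0 ≤ Y) (hc : Commute T Y)
    {f : ℝ≥0 → ℝ≥0} (hf : Continuous f)
    (hlow₀ : cfc (fun _ : ℝ≥0 => f 0) Y ≤ T)
    (hlow : ∀ t, 0 < t → cfc (fun y : ℝ≥0 => f t * min 1 (y / t)) Y ≤ T)
    (hup : ∀ t, 0 < t → T ≤ cfc (fun y : ℝ≥0 => f t * max 1 (y / t)) Y) :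
    T = cfc f Y := by
  have hYs := IsSelfAdjoint.of_nonneg hY
  have hTs := IsSelfAdjoint.of_nonneg hT
  set N : 𝓐 := Y + Complex.I • T with hN
  have hNs : star N = Y - Complex.I • T := by
    simp [hN, hYs.star_eq, hTs.star_eq, sub_eq_add_neg]
  have hNn : IsStarNormal N := ⟨by
    rw [hNs, hN]
    refine Commute.sub_left ?_ ?_
    · exact (Commute.refl Y).add_right (hc.symm.smul_right _)
    · exact (hc.smul_left _).add_right (Commute.refl _)⟩
  have hre : ((realPart N : selfAdjoint 𝓐) : 𝓐) = Y := by
    rw [realPart_apply_coe, hNs, hN]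
    simp only [add_add_sub_cancel]
    module
  have him : ((imaginaryPart N : selfAdjoint 𝓐) : 𝓐) = T := by
    rw [imaginaryPart_apply_coe, hNs, hN]
    have : Y + Complex.I • T - (Y - Complex.I • T) = (2 * Complex.I) • T := by module
    rw [this, ← Complex.coe_smul, smul_smul, smul_smul]
    have : (-Complex.I) * ((2⁻¹ : ℝ) : ℂ) * (2 * Complex.I) = 1 := by
      push_cast; ring_nf; simp
    rw [this, one_smul]
  have tr : ∀ g : ℝ≥0 → ℝ≥0, Continuous g →
      cfc g Y = cfc (fun z : ℂ => (((g z.re.toNNReal : ℝ≥0) : ℝ) : ℂ)) N := by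
    intro g hg
    rw [cfc_nnreal_eq_real g Y, ← hre]
    exact (cfc_comp_re (fun x : ℝ => ((g x.toNNReal : ℝ≥0) : ℝ)) N (by fun_prop)).symm
  have hTim : T = cfc (fun z : ℂ => ((z.im : ℝ) : ℂ)) N := by rw [cfc_im_id N, him]
  have hcont : ∀ g : ℝ≥0 → ℝ≥0, Continuous g →
      ContinuousOn (fun z : ℂ => (((g z.re.toNNReal : ℝ≥0) : ℝ) : ℂ)) (spectrum ℂ N) := by
    intro g hg
    have : Continuous (fun z : ℂ => (((g z.re.toNNReal : ℝ≥0) : ℝ) : ℂ)) := by fun_prop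
    exact this.continuousOn
  have lower : ∀ g : ℝ≥0 → ℝ≥0, Continuous g → cfc g Y ≤ T →
      ∀ z ∈ spectrum ℂ N, (g z.re.toNNReal : ℝ) ≤ z.im := by
    intro g hg h z hz
    rw [tr g hg, hTim, cfc_le_iff _ _ _ (hcont g hg) (by fun_prop)] at h
    exact_mod_cast h z hz
  have upper : ∀ g : ℝ≥0 → ℝ≥0, Continuous g → T ≤ cfc g Y →
      ∀ z ∈ spectrum ℂ N, z.im ≤ (g z.re.toNNReal : ℝ) := by
    intro g hg h z hz
    rw [tr g hg, hTim, cfc_le_iff _ _ _ (by fun_prop) (hcont g hg)] at h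
    exact_mod_cast h z hz
  have hc1 : ∀ t : ℝ≥0, Continuous (fun y : ℝ≥0 => f t * min 1 (y / t)) := fun t => by fun_prop
  have hc2 : ∀ t : ℝ≥0, Continuous (fun y : ℝ≥0 => f t * max 1 (y / t)) := fun t => by fun_prop
  conv_lhs => rw [hTim]
  rw [tr f hf]
  refine cfc_congr fun z hz => ?_
  simp only [Complex.ofReal_inj]
  rcases (zero_le (a := z.re.toNNReal)).eq_or_lt with h0 | h0
  · have l := lower _ (by fun_prop) hlow₀ z hz
    have u : ∀ t : ℝ≥0, 0 < t → z.im ≤ f t := by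
      intro t ht
      have := upper _ (hc2 t) (hup t ht) z hz
      simpa [← h0] using this
    rw [← h0]
    refine le_antisymm ?_ l
    have hl : Tendsto (fun t : ℝ≥0 => (f t : ℝ)) (𝓝[>] 0) (𝓝 (f 0 : ℝ)) :=
      ((NNReal.continuous_coe.comp hf).tendsto 0).mono_left nhdsWithin_le_nhds
    exact ge_of_tendsto hl (eventually_nhdsWithin_of_forall fun t ht => u t ht)
  · have l := lower _ (hc1 _) (hlow _ h0) z hz
    have u := upper _ (hc2 _) (hup _ h0) z hz
    simp only [div_self h0.ne', min_self, max_self, mul_one] at l u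
    exact le_antisymm u l

end CStarAlgebra

lemma IsStarProjection.nnreal_spectrum_eq_zero_or_one {𝓐 : Type*} [CStarAlgebra 𝓐]
    {P : 𝓐} (hP : IsStarProjection P) :
    ∀ t ∈ spectrum ℝ≥0 P, t = 0 ∨ t = 1 := by
  intro t ht
  have h1 : ((t : ℝ≥0) : ℝ) ∈ spectrum ℝ P := by
    simpa [NNReal.algebraMap_eq_coe] using spectrum.algebraMap_mem ℝ ht
  have := hP.isIdempotentElem.spectrum_subset ℝ h1
  simpa using this

section CStarAlgebra

variable {𝓐 : Type*} [CStarAlgebra 𝓐] [PartialOrder 𝓐] [StarOrderedRing 𝓐]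

lemma IsStarProjection.cfc_affine {P : 𝓐} (hP : IsStarProjection P) (a b : ℝ≥0) :
    cfc (fun t : ℝ≥0 => a * t + b * (1 - t)) P = (a : ℝ) • P + (b : ℝ) • (1 - P) := by
  have hP0 : 0 ≤ P := hP.nonneg
  have h1 : cfc (fun t : ℝ≥0 => 1 - t) P = 1 - P := by
    rw [eq_sub_iff_add_eq]
    nth_rewrite 2 [← cfc_id' ℝ≥0 P]
    rw [← cfc_add P _ _ (by fun_prop) (by fun_prop), ← cfc_one ℝ≥0 P]
    refine cfc_congr fun t ht => ?_
    rcases hP.nnreal_spectrum_eq_zero_or_one t ht with h | h <;> simp [h]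
  rw [cfc_add P _ _ (by fun_prop) (by fun_prop), cfc_const_mul _ _ P (by fun_prop),
    cfc_const_mul _ _ P (by fun_prop), h1, cfc_id' ℝ≥0 P]
  rfl

lemma IsStarProjection.cfc_apply {P : 𝓐} (hP : IsStarProjection P) {f : ℝ≥0 → ℝ≥0}
    (hf : Continuous f) (a b : ℝ≥0) :
    cfc f ((a : ℝ) • P + (b : ℝ) • (1 - P)) = (f a : ℝ) • P + (f b : ℝ) • (1 - P) := by
  have hP0 : 0 ≤ P := hP.nonneg
  rw [← hP.cfc_affine, ← hP.cfc_affine, ← cfc_comp' f _ P (by fun_prop) (by fun_prop)]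
  refine cfc_congr fun t ht => ?_
  rcases hP.nnreal_spectrum_eq_zero_or_one t ht with h | h <;> simp [h]

end CStarAlgebra

open InnerProductSpace in
lemma OperatorMonotone.harmonic_mean_le {f : ℝ≥0 → ℝ≥0} (hm : OperatorMonotone f)
    (hf : Continuous f) {x y z : ℝ≥0} (hx : 0 < x) (hz : 0 < z) {p q : ℝ}
    (hpq : p ^ 2 + q ^ 2 = 1) (h : (y : ℝ) * (p ^ 2 / x + q ^ 2 / z) ≤ 1) :
    (f y : ℝ) ≤ f x * p ^ 2 + f z * q ^ 2 ∧ (f y : ℝ) * p ^ 2 + f 0 * q ^ 2 ≤ f x := by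
  let u : EuclideanSpace ℂ (Fin 2) := !₂[1, 0]
  let e : EuclideanSpace ℂ (Fin 2) := !₂[(p : ℂ), (q : ℂ)]
  have hu : ‖u‖ = 1 := by simp [u, EuclideanSpace.norm_eq]
  have he : ‖e‖ = 1 := by simp [e, EuclideanSpace.norm_eq, hpq]
  let L := EuclideanSpace ℂ (Fin 2) →L[ℂ] EuclideanSpace ℂ (Fin 2)
  set P : L := rankOne ℂ u u
  set Q : L := rankOne ℂ e e
  have hP : IsStarProjection P := isStarProjection_rankOne_self hu
  have hQ : IsStarProjection Q := isStarProjection_rankOne_self he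
  have pos : ∀ {R : L}, IsStarProjection R → ∀ a b : ℝ≥0,
      ((a : ℝ) • R + (b : ℝ) • (1 - R)).IsPositive := by
    intro R hR a b
    rw [← ContinuousLinearMap.nonneg_iff_isPositive]
    exact add_nonneg (smul_nonneg a.2 hR.nonneg) (smul_nonneg b.2 hR.one_sub.nonneg)
  have quadP : ∀ (a b : ℝ) (v : EuclideanSpace ℂ (Fin 2)),
      (a • P + b • (1 - P) : L).reApplyInnerSelf v = a * ‖v 0‖ ^ 2 + b * ‖v 1‖ ^ 2 := by
    intro a b v
    simp [P, u, ContinuousLinearMap.reApplyInnerSelf_apply, PiLp.inner_apply, Complex.sq_norm,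
      Complex.normSq_apply]
    ring
  have quadQ : ∀ (a b : ℝ) (v : EuclideanSpace ℂ (Fin 2)),
      (a • Q + b • (1 - Q) : L).reApplyInnerSelf v =
      a * ‖p * v 0 + q * v 1‖ ^ 2 + b * (‖v 0‖ ^ 2 + ‖v 1‖ ^ 2 - ‖p * v 0 + q * v 1‖ ^ 2) := by
    intro a b v
    simp [Q, e, ContinuousLinearMap.reApplyInnerSelf_apply, PiLp.inner_apply, Complex.sq_norm,
      Complex.normSq_apply]
    ring
  have le_iff : ∀ S T : L, S ≤ T → ∀ v, S.reApplyInnerSelf v ≤ T.reApplyInnerSelf v := by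
    intro S T hST v
    have := ((ContinuousLinearMap.le_def _ _).1 hST).re_inner_nonneg_left v
    simp only [ContinuousLinearMap.reApplyInnerSelf_apply, sub_apply, inner_sub_left, map_sub]
      at this ⊢
    linarith
  have hle : ((y : ℝ) • Q + ((0 : ℝ≥0) : ℝ) • (1 - Q) : L) ≤
      (x : ℝ) • P + (z : ℝ) • (1 - P) := by
    rw [ContinuousLinearMap.le_def, ContinuousLinearMap.isPositive_def']
    refine ⟨(pos hP x z).isSelfAdjoint.sub (pos hQ y 0).isSelfAdjoint, fun v => ?_⟩
    have : ((x : ℝ) • P + (z : ℝ) • (1 - P) -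
        ((y : ℝ) • Q + ((0 : ℝ≥0) : ℝ) • (1 - Q)) : L).reApplyInnerSelf v =
        ((x : ℝ) • P + (z : ℝ) • (1 - P) : L).reApplyInnerSelf v -
        ((y : ℝ) • Q + ((0 : ℝ≥0) : ℝ) • (1 - Q) : L).reApplyInnerSelf v := by
      simp only [ContinuousLinearMap.reApplyInnerSelf_apply, sub_apply, inner_sub_left, map_sub]
    rw [this, quadP, quadQ]
    have hx' : (0 : ℝ) < x := hx
    have hz' : (0 : ℝ) < z := hz
    have cs : ∀ a b : ℝ,
        (p * a + q * b) ^ 2 ≤ (p ^ 2 / x + q ^ 2 / z) * (x * a ^ 2 + z * b ^ 2) := by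
      intro a b
      have : (p ^ 2 / x + q ^ 2 / z) * (x * a ^ 2 + z * b ^ 2) - (p * a + q * b) ^ 2 =
          (p * z * b - q * x * a) ^ 2 / (x * z) := by field_simp; ring
      have : 0 ≤ (p * z * b - q * x * a) ^ 2 / (x * z) := by positivity
      linarith
    have cs' : ∀ a b : ℝ, y * (p * a + q * b) ^ 2 ≤ x * a ^ 2 + z * b ^ 2 := by
      intro a b
      have h1 := mul_le_mul_of_nonneg_left (cs a b) y.2
      have h2 : 0 ≤ x * a ^ 2 + z * b ^ 2 := by positivity
      have h3 := mul_le_mul_of_nonneg_right h h2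
      change y * (p * a + q * b) ^ 2 ≤ y * _ at h1
      linarith
    have c1 := cs' (v 0).re (v 1).re
    have c2 := cs' (v 0).im (v 1).im
    simp [Complex.sq_norm, Complex.normSq_apply]
    nlinarith
  have main := hm (EuclideanSpace ℂ (Fin 2)) _ _ (pos hQ y 0) (pos hP x z) hle
  rw [hP.cfc_apply hf, hQ.cfc_apply hf] at main
  constructor
  · have := le_iff _ _ main e
    rw [quadP, quadQ] at this
    have e1 : (p : ℂ) * p + q * q = 1 := by
      rw [← sq, ← sq]; exact_mod_cast hpq
    simpa [e, e1, hpq] using this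
  · have := le_iff _ _ main u
    rw [quadP, quadQ] at this
    have e1 : (1 : ℝ) - p ^ 2 = q ^ 2 := by linarith
    simpa [u, e1] using this

lemma OperatorMonotone.eq_const_of_eq {f : ℝ≥0 → ℝ≥0} (hop : OperatorMonotone f)
    (hf : Continuous f) (hmono : Monotone f) {a b : ℝ≥0} (hab : a < b) (h : f a = f b) :
    ∀ y, f y = f 0 := by
  have weights : ∀ {x y z : ℝ≥0}, 0 < x → x < y → y < z → ∃ p q : ℝ, 0 < p ^ 2 ∧
      p ^ 2 + q ^ 2 = 1 ∧ (y : ℝ) * (p ^ 2 / x + q ^ 2 / z) ≤ 1 := by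
    intro x y z hx hxy hyz
    have hx' : (0 : ℝ) < x := hx
    have hxy' : (x : ℝ) < y := hxy
    have hyz' : (y : ℝ) < z := hyz
    set θ : ℝ := x * (z - y) / (y * (z - x)) with hθ
    have hy' : (0 : ℝ) < y := hx'.trans hxy'
    have hz' : (0 : ℝ) < z := hy'.trans hyz'
    have d1 : (0 : ℝ) < z - y := by linarith
    have d2 : (0 : ℝ) < z - x := by linarith
    have θ0 : 0 < θ := by positivity
    have θ1 : θ ≤ 1 := by
      rw [hθ, div_le_one (by positivity)]
      nlinarith
    refine ⟨√θ, √(1 - θ), ?_, ?_, ?_⟩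
    · rwa [Real.sq_sqrt θ0.le]
    · rw [Real.sq_sqrt θ0.le, Real.sq_sqrt (by linarith)]; ring
    · rw [Real.sq_sqrt θ0.le, Real.sq_sqrt (by linarith)]
      apply le_of_eq
      rw [hθ]
      field_simp
      ring
  obtain ⟨c, hac, hcb⟩ := exists_between hab
  have hcb' : f c = f b := le_antisymm (hmono hcb.le) (h ▸ hmono hac.le)
  have hc0 : 0 < c := (zero_le (a := a)).trans_lt hac
  have below : ∀ x, 0 < x → x < c → f x = f c := by
    intro x hx hxc
    obtain ⟨p, q, hp, hpq, hw⟩ := weights hx hxc hcb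
    have := (hop.harmonic_mean_le hf hx (hc0.trans hcb) hpq hw).1
    rw [← hcb'] at this
    refine le_antisymm (hmono hxc.le) ?_
    have h2 : (f c : ℝ) * p ^ 2 ≤ f x * p ^ 2 := by nlinarith
    exact_mod_cast le_of_mul_le_mul_right h2 hp
  have zero : f 0 = f c := by
    have h1 : Tendsto f (𝓝[>] 0) (𝓝 (f 0)) := (hf.tendsto 0).mono_left nhdsWithin_le_nhds
    have h2 : Tendsto f (𝓝[>] 0) (𝓝 (f c)) := by
      refine tendsto_const_nhds.congr' ?_
      filter_upwards [Ioo_mem_nhdsGT hc0] with x hx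
      exact (below x hx.1 hx.2).symm
    exact tendsto_nhds_unique h1 h2
  intro y
  rcases le_or_gt y c with hy | hy
  · exact le_antisymm (zero ▸ hmono hy) (hmono zero_le)
  · obtain ⟨p, q, hp, hpq, hw⟩ := weights hc0 hy (lt_add_one y)
    have := (hop.harmonic_mean_le hf hc0 ((hc0.trans hy).trans (lt_add_one y)) hpq hw).2
    refine le_antisymm ?_ (hmono zero_le)
    rw [← zero] at this
    have h2 : (f y : ℝ) * p ^ 2 ≤ f 0 * p ^ 2 := by nlinarith
    exact_mod_cast le_of_mul_le_mul_right h2 hp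

namespace IsConnection

variable {σ : (H →L[ℂ] H) → (H →L[ℂ] H) → (H →L[ℂ] H)}

lemma mono' (hσ : IsConnection σ) {A B C D : H →L[ℂ] H} (hA : 0 ≤ A) (hB : 0 ≤ B)
    (hAC : A ≤ C) (hBD : B ≤ D) : σ A B ≤ σ C D :=
  hσ.mono A B C D ((nonneg_iff_isPositive A).1 hA) ((nonneg_iff_isPositive B).1 hB)
    ((nonneg_iff_isPositive C).1 (hA.trans hAC)) ((nonneg_iff_isPositive D).1 (hB.trans hBD))
    hAC hBD

lemma transformer' (hσ : IsConnection σ) {A B C : H →L[ℂ] H} (hA : 0 ≤ A) (hB : 0 ≤ B)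
    (hC : 0 ≤ C) : C * σ A B * C ≤ σ (C * A * C) (C * B * C) :=
  hσ.transformer A B C ((nonneg_iff_isPositive A).1 hA) ((nonneg_iff_isPositive B).1 hB)
    ((nonneg_iff_isPositive C).1 hC)

lemma nonneg (hσ : IsConnection σ) {A B : H →L[ℂ] H} (hA : 0 ≤ A) (hB : 0 ≤ B) : 0 ≤ σ A B :=
  (nonneg_iff_isPositive _).2
    (hσ.isPositive A B ((nonneg_iff_isPositive A).1 hA) ((nonneg_iff_isPositive B).1 hB))

lemma conjugate_eq (hσ : IsConnection σ) {A B C D : H →L[ℂ] H} (hA : 0 ≤ A) (hB : 0 ≤ B)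
    (hC : 0 ≤ C) (hD : 0 ≤ D) (hCD : C * D = 1) (hDC : D * C = 1) :
    C * σ A B * C = σ (C * A * C) (C * B * C) := by
  refine le_antisymm (hσ.transformer' hA hB hC) ?_
  have cancel : ∀ X : H →L[ℂ] H, D * (C * X * C) * D = X := fun X => by
    rw [show D * (C * X * C) * D = (D * C) * X * (C * D) by simp only [mul_assoc], hCD, hDC,
      one_mul, mul_one]
  have h1 := hσ.transformer' (conjugate_nonneg_of_nonneg hA hC)
    (conjugate_nonneg_of_nonneg hB hC) hD
  rw [cancel, cancel] at h1
  have h2 := conjugate_le_conjugate_of_nonneg h1 hC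
  rwa [show ∀ X : H →L[ℂ] H, C * (D * X * D) * C = (C * D) * X * (D * C) from
    fun X => by simp only [mul_assoc], hCD, hDC, one_mul, mul_one] at h2

end IsConnection

section RepresentingFunction

variable {σ : (H →L[ℂ] H) → (H →L[ℂ] H) → (H →L[ℂ] H)} {f : ℝ≥0 → ℝ≥0}

lemma smul_one_le_smul_one_iff [Nontrivial H] {a b : ℝ} :
    a • (1 : H →L[ℂ] H) ≤ b • (1 : H →L[ℂ] H) ↔ a ≤ b := by
  refine ⟨fun h => ?_, fun h => smul_le_smul_of_nonneg_right h zero_le_one⟩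
  by_contra! hlt
  have h1 : (a - b) • (1 : H →L[ℂ] H) = 0 := by
    refine le_antisymm ?_ (smul_nonneg (by linarith) zero_le_one)
    rw [sub_smul]
    exact sub_nonpos.2 h
  rcases smul_eq_zero.1 h1 with h2 | h2
  · linarith
  · exact one_ne_zero h2

lemma IsRepresentingFunction.monotone [Nontrivial H] (hσ : IsConnection σ)
    (hf : IsRepresentingFunction σ f) : Monotone f := by
  intro x y hxy
  have := hσ.mono' (A := 1) (C := 1) (B := (x : ℝ) • 1) (D := (y : ℝ) • 1) zero_le_one
    (smul_nonneg x.2 zero_le_one) le_rfl (smul_one_le_smul_one_iff.2 hxy)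
  rw [hf.2, hf.2, smul_one_le_smul_one_iff] at this
  exact_mod_cast this

lemma IsRepresentingFunction.mul_le_mul [Nontrivial H] (hσ : IsConnection σ)
    (hf : IsRepresentingFunction σ f) {s t : ℝ≥0} (hst : s ≤ t) : s * f t ≤ t * f s := by
  rcases (zero_le (a := t)).eq_or_lt with h0 | ht
  · have : s = 0 := le_antisymm (hst.trans h0.symm.le) zero_le
    simp [this]
  have ht' : (0 : ℝ) < t := ht
  have conj : ∀ (c : ℝ≥0) (X : H →L[ℂ] H),
      (√(c : ℝ) • (1 : H →L[ℂ] H)) * X * (√(c : ℝ) • 1) = (c : ℝ) • X := by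
    intro c X
    simp [smul_smul]
  have nn : ∀ c : ℝ≥0, (0 : H →L[ℂ] H) ≤ √(c : ℝ) • 1 := fun c =>
    smul_nonneg (Real.sqrt_nonneg _) zero_le_one
  have nn' : ∀ c : ℝ≥0, (0 : H →L[ℂ] H) ≤ (c : ℝ) • 1 := fun c =>
    smul_nonneg c.2 zero_le_one
  have h1 := hσ.transformer' zero_le_one (nn' t) (nn s)
  have h2 := hσ.conjugate_eq (D := (√(t : ℝ))⁻¹ • 1) zero_le_one (nn' s) (nn t)
    (smul_nonneg (by positivity) zero_le_one)
    (by simp [smul_smul, (Real.sqrt_pos.2 ht').ne'])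
    (by simp [smul_smul, (Real.sqrt_pos.2 ht').ne'])
  rw [conj, conj, conj, hf.2, smul_smul, smul_smul] at h1 h2
  have h3 : σ ((s : ℝ) • 1) (((s : ℝ) * t) • 1) ≤ σ ((t : ℝ) • 1) (((t : ℝ) * s) • 1) := by
    rw [mul_comm (t : ℝ)]
    exact hσ.mono' (nn' s) (smul_nonneg (by positivity) zero_le_one)
      (smul_one_le_smul_one_iff.2 hst) le_rfl
  have h4 := h1.trans (h3.trans h2.symm.le)
  rw [smul_one_le_smul_one_iff] at h4
  exact_mod_cast h4

lemma IsRepresentingFunction.continuousAt_zero [Nontrivial H] (hσ : IsConnection σ)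
    (hf : IsRepresentingFunction σ f) : ContinuousAt f 0 := by
  have hanti : Antitone fun n : ℕ => (1 / ((n : ℝ) + 1)) := fun m n h =>
    one_div_le_one_div_of_le (by positivity) (by gcongr)
  have hlim := tendsto_one_div_add_atTop_nhds_zero_nat (𝕜 := ℝ)
  have h1 : SOTTendsto (fun n : ℕ => σ 1 ((1 / ((n : ℝ) + 1)) • 1)) (σ 1 0) := by
    refine (hσ.contFromAbove (fun _ => 1) (fun n => (1 / ((n : ℝ) + 1)) • 1) 1 0
      (fun _ => isPositive_one) (fun n => ?_) isPositive_one isPositive_zero antitone_const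
      (fun m n h => smul_le_smul_of_nonneg_right (hanti h) zero_le_one)
      (fun x => tendsto_const_nhds) (fun x => ?_)).2
    · exact (nonneg_iff_isPositive _).1 (smul_nonneg (by positivity) zero_le_one)
    · simpa using hlim.smul_const x
  obtain ⟨x, hx⟩ := exists_ne (0 : H)
  have h2 : Tendsto (fun n : ℕ => f (1 / ((n : ℝ≥0) + 1))) atTop (𝓝 (f 0)) := by
    have h3 := (h1 x).norm
    have e0 : σ 1 0 = (f 0 : ℝ) • 1 := by simpa using hf.2 0
    have e : ∀ n : ℕ, σ 1 ((1 / ((n : ℝ) + 1)) • 1) = (f (1 / ((n : ℝ≥0) + 1)) : ℝ) • 1 := by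
      intro n
      simpa using hf.2 (1 / ((n : ℝ≥0) + 1))
    simp only [e0, e, smul_apply, one_apply_eq_self, norm_smul, NNReal.norm_eq] at h3
    have h4 := h3.mul_const (‖x‖⁻¹)
    simp only [mul_assoc, mul_inv_cancel₀ (norm_ne_zero_iff.2 hx), mul_one] at h4
    exact_mod_cast h4
  rw [ContinuousAt, tendsto_order]
  refine ⟨fun a ha => Eventually.of_forall fun y => ha.trans_le (hf.monotone hσ zero_le),
    fun a ha => ?_⟩
  obtain ⟨n, hn⟩ := ((tendsto_order.1 h2).2 a ha).exists
  filter_upwards [Iio_mem_nhds (show (0 : ℝ≥0) < 1 / ((n : ℝ≥0) + 1) by positivity)] with y hy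
  exact (hf.monotone hσ (le_of_lt hy)).trans_lt hn

lemma IsRepresentingFunction.continuous [Nontrivial H] (hσ : IsConnection σ)
    (hf : IsRepresentingFunction σ f) : Continuous f := by
  rw [continuous_iff_continuousAt]
  intro t
  rcases (zero_le (a := t)).eq_or_lt with h0 | ht
  · rw [← h0]
    exact hf.continuousAt_zero hσ
  have lo : Tendsto (fun s : ℝ≥0 => min 1 (s / t) * f t) (𝓝 t) (𝓝 (f t)) := by
    have : Continuous (fun s : ℝ≥0 => min 1 (s / t) * f t) := by fun_prop
    simpa [div_self ht.ne'] using this.tendsto t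
  have hi : Tendsto (fun s : ℝ≥0 => max 1 (s / t) * f t) (𝓝 t) (𝓝 (f t)) := by
    have : Continuous (fun s : ℝ≥0 => max 1 (s / t) * f t) := by fun_prop
    simpa [div_self ht.ne'] using this.tendsto t
  refine tendsto_of_tendsto_of_tendsto_of_le_of_le lo hi (fun s => ?_) (fun s => ?_)
  · rcases le_total s t with h | h
    · refine (mul_le_mul_left (min_le_right _ _) _).trans ?_
      rw [div_mul_eq_mul_div]
      exact div_le_of_le_mul₀ zero_le zero_le (by rw [mul_comm (f s)]; exact hf.mul_le_mul hσ h)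
    · refine (mul_le_mul_left (min_le_left _ _) _).trans ?_
      rw [one_mul]
      exact hf.monotone hσ h
  · rcases le_total s t with h | h
    · refine le_trans ?_ (mul_le_mul_left (le_max_left _ _) _)
      rw [one_mul]
      exact hf.monotone hσ h
    · refine le_trans ?_ (mul_le_mul_left (le_max_right _ _) _)
      rw [div_mul_eq_mul_div, le_div_iff₀ ht, mul_comm]
      exact hf.mul_le_mul hσ h

lemma IsRepresentingFunction.commute (hσ : IsConnection σ) {Y : H →L[ℂ] H} (hY : 0 ≤ Y) :
    Commute (σ 1 Y) Y := by
  refine commute_of_conjugate_le (hσ.nonneg zero_le_one hY) hY fun k hk hk1 hkY => ?_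
  have hkk : k * k ≤ 1 := by
    have : 0 ≤ (1 + k) * (1 - k) := Commute.mul_nonneg (add_nonneg zero_le_one hk)
      (sub_nonneg.2 hk1) (by
        refine ((Commute.one_left _).add_left ?_)
        exact (Commute.one_right k).sub_right (Commute.refl k))
    rw [← sub_nonneg]
    convert this using 1
    noncomm_ring
  have hkYk : k * Y * k ≤ Y := by
    have : 0 ≤ Y * (1 - k * k) := Commute.mul_nonneg hY (sub_nonneg.2 hkk)
      ((Commute.one_right Y).sub_right (hkY.symm.mul_right hkY.symm))
    rw [← sub_nonneg]
    convert this using 1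
    rw [hkY.eq, mul_sub, mul_one, mul_assoc]
  refine (hσ.transformer' zero_le_one hY hk).trans (hσ.mono' ?_ ?_ ?_ hkYk)
  · exact conjugate_nonneg_of_nonneg zero_le_one hk
  · exact conjugate_nonneg_of_nonneg hY hk
  · rwa [mul_one]

lemma cfc_sqrt_mul_self {Y : H →L[ℂ] H} {g : ℝ≥0 → ℝ≥0} (hg : Continuous g) :
    cfc (fun y => NNReal.sqrt (g y)) Y * cfc (fun y => NNReal.sqrt (g y)) Y = cfc g Y := by
  rw [← cfc_mul _ _ Y (by fun_prop) (by fun_prop)]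
  simp

lemma real_smul_cfc {Y : H →L[ℂ] H} (c : ℝ≥0) {g : ℝ≥0 → ℝ≥0} (hg : Continuous g) :
    (c : ℝ) • cfc g Y = cfc (fun y => c * g y) Y := by
  rw [cfc_const_mul _ _ Y (by fun_prop)]
  rfl

lemma IsRepresentingFunction.lower_bound (hσ : IsConnection σ)
    (hf : IsRepresentingFunction σ f) {Y : H →L[ℂ] H} (hY : 0 ≤ Y) {t : ℝ≥0} (ht : 0 < t) :
    cfc (fun y : ℝ≥0 => f t * min 1 (y / t)) Y ≤ σ 1 Y := by
  set g : ℝ≥0 → ℝ≥0 := fun y => min 1 (y / t) with hg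
  have hgc : Continuous g := by fun_prop
  set k := cfc (fun y => NNReal.sqrt (g y)) Y with hk
  have hk0 : 0 ≤ k := cfc_predicate _ _
  have hkk : k * k = cfc g Y := cfc_sqrt_mul_self hgc
  have h1 := hσ.transformer' (A := 1) (B := (t : ℝ) • 1) zero_le_one
    (smul_nonneg t.2 zero_le_one) hk0
  rw [hf.2, mul_one] at h1
  simp only [mul_smul_comm, smul_mul_assoc, mul_one, hkk] at h1
  rw [real_smul_cfc _ hgc, real_smul_cfc _ hgc] at h1
  refine h1.trans (hσ.mono' (cfc_predicate _ _) (cfc_predicate _ _) ?_ ?_)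
  · exact cfc_le_one _ _ fun y _ => min_le_left _ _
  · conv_rhs => rw [← cfc_id' ℝ≥0 Y]
    refine cfc_mono (fun y _ => ?_) (by fun_prop) (by fun_prop)
    calc t * min 1 (y / t) ≤ t * (y / t) := by gcongr; exact min_le_right _ _
      _ = y := mul_div_cancel₀ _ ht.ne'

lemma IsRepresentingFunction.upper_bound (hσ : IsConnection σ)
    (hf : IsRepresentingFunction σ f) {Y : H →L[ℂ] H} (hY : 0 ≤ Y) {t : ℝ≥0} (ht : 0 < t) :
    σ 1 Y ≤ cfc (fun y : ℝ≥0 => f t * max 1 (y / t)) Y := by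
  set g : ℝ≥0 → ℝ≥0 := fun y => max 1 (y / t) with hg
  have hgc : Continuous g := by fun_prop
  have hg1 : ∀ y, 1 ≤ g y := fun y => le_max_left _ _
  have hg0 : ∀ y, g y ≠ 0 := fun y => (zero_lt_one.trans_le (hg1 y)).ne'
  have hgi : Continuous fun y => (g y)⁻¹ := hgc.inv₀ hg0
  set k := cfc (fun y => NNReal.sqrt (g y)) Y with hk
  set h := cfc (fun y => NNReal.sqrt ((g y)⁻¹)) Y with hh
  have hk0 : 0 ≤ k := cfc_predicate _ _
  have hh0 : 0 ≤ h := cfc_predicate _ _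
  have hkk : k * k = cfc g Y := cfc_sqrt_mul_self hgc
  have hhh : h * h = cfc (fun y => (g y)⁻¹) Y := cfc_sqrt_mul_self hgi
  have hkh : k * h = 1 := by
    rw [hk, hh, ← cfc_mul (fun y => NNReal.sqrt (g y)) (fun y => NNReal.sqrt (g y)⁻¹) Y
      (by fun_prop) (NNReal.continuous_sqrt.comp hgi).continuousOn, ← cfc_one ℝ≥0 Y]
    refine cfc_congr fun y _ => ?_
    simp [← NNReal.sqrt_mul, mul_inv_cancel₀ (hg0 y)]
  have hhk : h * k = 1 := by rw [← hkh]; exact cfc_commute_cfc _ _ _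
  have hhY : h * Y * h = cfc (fun y => y * (g y)⁻¹) Y := by
    have : Commute h Y := by
      conv_rhs => rw [← cfc_id' ℝ≥0 Y]
      exact cfc_commute_cfc _ _ _
    rw [this.eq, mul_assoc, hhh, cfc_mul _ _ Y (by fun_prop) hgi.continuousOn, cfc_id' ℝ≥0 Y]
  have h1 := hσ.transformer' (A := 1) (B := Y) zero_le_one hY hh0
  rw [mul_one, hhh, hhY] at h1
  have h2 : σ (cfc (fun y => (g y)⁻¹) Y) (cfc (fun y => y * (g y)⁻¹) Y) ≤ (f t : ℝ) • 1 := by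
    rw [← hf.2 t]
    refine hσ.mono' (cfc_predicate _ _) (cfc_predicate _ _) ?_ ?_
    · exact cfc_le_one _ _ fun y _ => inv_le_one_of_one_le₀ (hg1 y)
    · have := cfc_le_algebraMap (fun y => y * (g y)⁻¹) t Y (fun y _ => by
        rw [← div_eq_mul_inv]
        refine div_le_of_le_mul₀ zero_le zero_le ?_
        calc y = t * (y / t) := (mul_div_cancel₀ _ ht.ne').symm
          _ ≤ t * g y := by gcongr; exact le_max_right _ _) (by fun_prop)
      rwa [Algebra.algebraMap_eq_smul_one] at this
  have h3 := conjugate_le_conjugate_of_nonneg (h1.trans h2) hk0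
  rw [show k * (h * σ 1 Y * h) * k = (k * h) * σ 1 Y * (h * k) by simp only [mul_assoc], hkh, hhk,
    one_mul, mul_one] at h3
  simpa only [mul_smul_comm, smul_mul_assoc, mul_one, hkk, real_smul_cfc _ hgc] using h3

lemma IsRepresentingFunction.one_conn [Nontrivial H] (hσ : IsConnection σ)
    (hf : IsRepresentingFunction σ f) {Y : H →L[ℂ] H} (hY : 0 ≤ Y) : σ 1 Y = cfc f Y := by
  refine eq_cfc_of_commute_of_bounds (hσ.nonneg zero_le_one hY) hY
    (IsRepresentingFunction.commute hσ hY) (hf.continuous hσ) ?_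
    (fun t ht => hf.lower_bound hσ hY ht) (fun t ht => hf.upper_bound hσ hY ht)
  rw [cfc_const _ Y, Algebra.algebraMap_eq_smul_one]
  have h0 : σ 1 0 = (f 0 : ℝ) • 1 := by simpa using hf.2 0
  change (f 0 : ℝ) • (1 : H →L[ℂ] H) ≤ _
  rw [← h0]
  exact hσ.mono' zero_le_one le_rfl le_rfl hY

lemma sqrt_mul_rpow_neg_half {A : H →L[ℂ] H} (hA : 0 ≤ A) (hAu : IsUnit A) :
    CFC.sqrt A * CFC.rpow A (-(1/2) : ℝ) = 1 ∧ CFC.rpow A (-(1/2) : ℝ) * CFC.sqrt A = 1 := by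
  have hs : IsStrictlyPositive A := hAu.isStrictlyPositive hA
  rw [CFC.sqrt_eq_rpow]
  exact ⟨CFC.rpow_mul_rpow_neg _ hs, CFC.rpow_neg_mul_rpow _ hs⟩

lemma IsRepresentingFunction.conn_eq [Nontrivial H] (hσ : IsConnection σ)
    (hf : IsRepresentingFunction σ f) {A X : H →L[ℂ] H} (hA : 0 ≤ A) (hAu : IsUnit A)
    (hX : 0 ≤ X) :
    σ A X = CFC.sqrt A *
      cfc f (CFC.rpow A (-(1/2) : ℝ) * X * CFC.rpow A (-(1/2) : ℝ)) * CFC.sqrt A := by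
  obtain ⟨h1, h2⟩ := sqrt_mul_rpow_neg_half hA hAu
  set S := CFC.sqrt A
  set R := CFC.rpow A (-(1/2) : ℝ)
  have hS : 0 ≤ S := CFC.sqrt_nonneg A
  have hR : 0 ≤ R := CFC.rpow_nonneg
  have hY : 0 ≤ R * X * R := conjugate_nonneg_of_nonneg hX hR
  rw [← hf.one_conn hσ hY, hσ.conjugate_eq zero_le_one hY hS hR h1 h2, mul_one,
    CFC.sqrt_mul_sqrt_self A hA,
    show S * (R * X * R) * S = (S * R) * X * (R * S) by simp only [mul_assoc], h1, h2, one_mul,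
    mul_one]

lemma IsRepresentingFunction.conn_eq_smul_of_const [Nontrivial H] (hσ : IsConnection σ)
    (hf : IsRepresentingFunction σ f) (hc : ∀ y, f y = f 0) {A B : H →L[ℂ] H} (hA : 0 ≤ A)
    (hB : 0 ≤ B) : σ A B = (f 0 : ℝ) • A := by
  have hfc : f = fun _ => f 0 := funext hc
  have inv : ∀ C : H →L[ℂ] H, 0 ≤ C → IsUnit C → σ C B = (f 0 : ℝ) • C := by
    intro C hC hCu
    have hR : 0 ≤ CFC.rpow C (-(1/2) : ℝ) := CFC.rpow_nonneg
    have hY := conjugate_nonneg_of_nonneg hB hR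
    rw [hf.conn_eq hσ hC hCu hB, hfc, cfc_const _ _ hY, Algebra.algebraMap_eq_smul_one,
      mul_smul_comm, smul_mul_assoc, mul_one, CFC.sqrt_mul_sqrt_self C hC]
    rfl
  have hanti : Antitone fun n : ℕ => (1 / ((n : ℝ) + 1)) := fun m n h =>
    one_div_le_one_div_of_le (by positivity) (by gcongr)
  have hlim := tendsto_one_div_add_atTop_nhds_zero_nat (𝕜 := ℝ)
  have hnn : ∀ n : ℕ, 0 ≤ A + (1 / ((n : ℝ) + 1)) • (1 : H →L[ℂ] H) := fun n =>
    add_nonneg hA (smul_nonneg (by positivity) zero_le_one)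
  have hB' := (nonneg_iff_isPositive B).1 hB
  have hSOT : SOTTendsto (fun n : ℕ => A + (1 / ((n : ℝ) + 1)) • (1 : H →L[ℂ] H)) A := fun x => by
    simpa using (tendsto_const_nhds (x := A x)).add (hlim.smul_const x)
  have hlim2 := (hσ.contFromAbove (fun n : ℕ => A + (1 / ((n : ℝ) + 1)) • (1 : H →L[ℂ] H))
    (fun _ => B) A B (fun n => (nonneg_iff_isPositive _).1 (hnn n)) (fun _ => hB')
    ((nonneg_iff_isPositive A).1 hA) hB'
    (fun m n h => add_le_add_right (smul_le_smul_of_nonneg_right (hanti h) zero_le_one) _)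
    antitone_const hSOT (fun x => tendsto_const_nhds)).2
  have hunit : ∀ n : ℕ, IsUnit (A + (1 / ((n : ℝ) + 1)) • (1 : H →L[ℂ] H)) := fun n => by
    have h1 : IsStrictlyPositive ((1 / ((n : ℝ) + 1)) • (1 : H →L[ℂ] H)) :=
      IsStrictlyPositive.smul (by positivity) (isUnit_one.isStrictlyPositive zero_le_one)
    exact (h1.nonneg_add hA).isUnit
  ext x
  refine tendsto_nhds_unique (hlim2 x) ?_
  simp only [inv _ (hnn _) (hunit _)]
  exact (hSOT x).const_smul _

lemma IsRepresentingFunction.strictMono [Nontrivial H] (hσ : IsConnection σ)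
    (hf : IsRepresentingFunction σ f)
    (hnl : ¬ ∃ k : ℝ≥0, ∀ A B : H →L[ℂ] H, A.IsPositive → B.IsPositive →
      σ A B = (k : ℝ) • A) : StrictMono f := by
  intro a b hab
  refine lt_of_le_of_ne (hf.monotone hσ hab.le) fun h => hnl ⟨f 0, fun A B hA hB => ?_⟩
  exact hf.conn_eq_smul_of_const hσ
    (hf.1.eq_const_of_eq (hf.continuous hσ) (hf.monotone hσ) hab h)
    ((nonneg_iff_isPositive A).2 hA) ((nonneg_iff_isPositive B).2 hB)

end RepresentingFunction

lemma StrictMono.continuousOn_invFun_range {f : ℝ≥0 → ℝ≥0} (hf : StrictMono f)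
    (hc : Continuous f) : ContinuousOn (Function.invFun f) (Set.range f) := by
  have hemb : IsEmbedding f :=
    hf.isEmbedding_of_ordConnected (isPreconnected_range hc).ordConnected
  rw [continuousOn_iff_continuous_domRestrict, hemb.continuous_iff]
  convert continuous_subtype_val using 1
  ext ⟨y, hy⟩
  simp [Function.invFun_eq hy]


/-- Solvability and the solution of the equation `A σ X = B`
for a connection that is not a scalar multiple of the left-trivial mean. -/
theorem solve_left_equation [Nontrivial H]
    (σ : (H →L[ℂ] H) → (H →L[ℂ] H) → (H →L[ℂ] H)) (hσ : IsConnection σ)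
    (hnl : ¬ ∃ k : ℝ≥0, ∀ A B : H →L[ℂ] H, A.IsPositive → B.IsPositive →
      σ A B = (k : ℝ) • A)
    (f : ℝ≥0 → ℝ≥0) (hf : IsRepresentingFunction σ f)
    (A B : H →L[ℂ] H) (hA : A.IsPositive) (hAu : IsUnit A) (hB : B.IsPositive) :
    ((∃ X : H →L[ℂ] H, X.IsPositive ∧ σ A X = B) ↔
      spectrum ℝ≥0 (CFC.rpow A (-(1/2) : ℝ) * B * CFC.rpow A (-(1/2) : ℝ)) ⊆
        Set.range f) ∧
    ∀ X : H →L[ℂ] H, X.IsPositive → σ A X = B →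
      X = CFC.sqrt A *
            cfc (Function.invFun f)
              (CFC.rpow A (-(1/2) : ℝ) * B * CFC.rpow A (-(1/2) : ℝ)) *
          CFC.sqrt A := by
  have hA0 : 0 ≤ A := (nonneg_iff_isPositive A).2 hA
  have hB0 : 0 ≤ B := (nonneg_iff_isPositive B).2 hB
  obtain ⟨hSR, hRS⟩ := sqrt_mul_rpow_neg_half hA0 hAu
  have hsm := hf.strictMono hσ hnl
  have hfc := hf.continuous hσ
  have hinv := hsm.continuousOn_invFun_range hfc
  have hconn : ∀ {X : H →L[ℂ] H}, 0 ≤ X → _ := fun {X} hX => hf.conn_eq hσ hA0 hAu hX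
  have hS : 0 ≤ CFC.sqrt A := CFC.sqrt_nonneg A
  have hR : 0 ≤ CFC.rpow A (-(1/2) : ℝ) := CFC.rpow_nonneg
  set S := CFC.sqrt A
  set R := CFC.rpow A (-(1/2) : ℝ)
  have cancel : ∀ Y : H →L[ℂ] H, R * (S * Y * S) * R = Y := fun Y => by
    rw [show R * (S * Y * S) * R = (R * S) * Y * (S * R) by simp only [mul_assoc], hRS, hSR,
      one_mul, mul_one]
  have cancel' : ∀ Y : H →L[ℂ] H, S * (R * Y * R) * S = Y := fun Y => by
    rw [show S * (R * Y * R) * S = (S * R) * Y * (R * S) by simp only [mul_assoc], hRS, hSR,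
      one_mul, mul_one]
  have key : ∀ X : H →L[ℂ] H, 0 ≤ X → σ A X = B → R * B * R = cfc f (R * X * R) := by
    rintro X hX rfl
    rw [hconn hX, cancel]
  refine ⟨⟨?_, fun hspec => ?_⟩, fun X hX hXB => ?_⟩
  · rintro ⟨X, hX, hXB⟩
    have hX0 := (nonneg_iff_isPositive X).2 hX
    rw [key X hX0 hXB, cfc_map_spectrum f (R * X * R) (conjugate_nonneg_of_nonneg hX0 hR)
      hfc.continuousOn]
    exact Set.image_subset_range _ _
  · have hZ : 0 ≤ R * B * R := conjugate_nonneg_of_nonneg hB0 hR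
    have hX : 0 ≤ S * cfc (Function.invFun f) (R * B * R) * S :=
      conjugate_nonneg_of_nonneg (cfc_predicate _ _) hS
    refine ⟨_, (nonneg_iff_isPositive _).1 hX, ?_⟩
    rw [hconn hX, cancel,
      ← cfc_comp' f (Function.invFun f) (R * B * R) hfc.continuousOn (hinv.mono hspec),
      cfc_congr (g := fun x => x) fun y hy => Function.invFun_eq (hspec hy),
      cfc_id' ℝ≥0 (R * B * R),
      cancel']
  · have hX0 := (nonneg_iff_isPositive X).2 hX
    have hY : 0 ≤ R * X * R := conjugate_nonneg_of_nonneg hX0 hR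
    rw [key X hX0 hXB,
      ← cfc_comp' (Function.invFun f) f (R * X * R) (hinv.mono (Set.image_subset_range _ _))
        hfc.continuousOn]
    simp only [Function.leftInverse_invFun hsm.injective _]
    rw [cfc_id' ℝ≥0 (R * X * R), cancel']

end
end

section
/- Let f : [0,∞) → [0,∞) be an operator monotone function admitting the integral representation f(x) = ∫_{[0,1]} (1 !ₜ x) dμ(t) for a finite Borel measure μ on [0,1]. Then lim_{x→0⁺} x·f(1/x) = lim_{x→∞} f(x)/x = μ({1}); that is, the transpose g of f satisfies g(0) = μ({1}). Consequently, the transpose of the connection associated with μ is nonregular (g(0) = 0) if and only if μ({1}) = 0. -/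
open ContinuousLinearMap Filter Topology MeasureTheory
open scoped NNReal ENNReal

set_option synthInstance.maxHeartbeats 1000000
set_option maxHeartbeats 1000000

noncomputable section

variable {H : Type} [NormedAddCommGroup H] [InnerProductSpace ℂ H] [CompleteSpace H]

theorem measurable_harmKernel (x : ℝ≥0) : Measurable fun t => harmKernel t x := by
  unfold harmKernel
  exact Measurable.ite (measurableSet_singleton 0) measurable_const (by fun_prop)

theorem one_le_harmKernel_denominator {t : ℝ} (ht : t ∈ Set.Icc (0 : ℝ) 1) {x : ℝ≥0}
    (hx : 1 ≤ x) : 1 ≤ (1 - t) * (x : ℝ) + t := by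
  have hx' : (1 : ℝ) ≤ x := by exact_mod_cast hx
  nlinarith [mul_nonneg (sub_nonneg.2 ht.2) (sub_nonneg.2 hx')]

theorem harmKernel_div_of_ne_zero {t : ℝ} (ht : t ≠ 0) {x : ℝ≥0} (hx : x ≠ 0) :
    harmKernel t x / x = ENNReal.ofReal ((1 - t) * (x : ℝ) + t)⁻¹ := by
  have hx' : (0 : ℝ) < x := by exact_mod_cast pos_iff_ne_zero.2 hx
  rw [harmKernel, if_neg ht, ← ENNReal.ofReal_coe_nnreal, ← ENNReal.ofReal_div_of_pos hx']
  congr 1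
  rw [div_div, mul_comm, ← div_div, div_self hx'.ne', one_div]

theorem harmKernel_div_le_one {t : ℝ} (ht : t ∈ Set.Icc (0 : ℝ) 1) {x : ℝ≥0} (hx : 1 ≤ x) :
    harmKernel t x / x ≤ 1 := by
  rcases eq_or_ne t 0 with rfl | h0
  · rw [harmKernel, if_pos rfl]
    exact ENNReal.div_le_of_le_mul (by simpa using hx)
  · rw [harmKernel_div_of_ne_zero h0 (one_pos.trans_le hx).ne', ENNReal.ofReal_le_one]
    exact inv_le_one_of_one_le₀ (one_le_harmKernel_denominator ht hx)

theorem tendsto_harmKernel_div_atTop {t : ℝ} (ht : t ∈ Set.Icc (0 : ℝ) 1) :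
    Tendsto (fun x : ℝ≥0 => harmKernel t x / x) atTop
      (𝓝 (({1} : Set ℝ).indicator 1 t)) := by
  have hev := eventually_ne_atTop (0 : ℝ≥0)
  rcases eq_or_ne t 1 with rfl | h1
  · refine tendsto_const_nhds.congr' (hev.mono fun x hx => ?_)
    beta_reduce
    rw [harmKernel_div_of_ne_zero one_ne_zero hx]
    simp
  rw [Set.indicator_of_notMem (by simpa using h1)]
  rcases eq_or_ne t 0 with rfl | h0
  · simp only [harmKernel, if_true, one_div]
    rw [← ENNReal.inv_top]
    exact (ENNReal.tendsto_coe_nhds_top.2 tendsto_id).inv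
  · have hlim : Tendsto (fun x : ℝ≥0 => ((1 - t) * (x : ℝ) + t)⁻¹) atTop (𝓝 0) :=
      (tendsto_atTop_add_const_right _ t ((NNReal.tendsto_coe_atTop.2 tendsto_id).const_mul_atTop
        (sub_pos.2 (lt_of_le_of_ne ht.2 h1)))).inv_tendsto_atTop
    rw [← ENNReal.ofReal_zero]
    refine (ENNReal.tendsto_ofReal hlim).congr' (hev.mono fun x hx => ?_)
    beta_reduce
    rw [harmKernel_div_of_ne_zero h0 hx]

theorem IsAssociatedMeasure.tendsto_div_atTop {f : ℝ≥0 → ℝ≥0} {μ : Measure ℝ}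
    [IsFiniteMeasure μ] (hμ : IsAssociatedMeasure f μ) :
    Tendsto (fun x : ℝ≥0 => f x / x) atTop (𝓝 (μ {(1 : ℝ)}).toNNReal) := by
  have hlim : Tendsto (fun x : ℝ≥0 => ∫⁻ t in Set.Icc (0 : ℝ) 1, harmKernel t x / x ∂μ) atTop
      (𝓝 (∫⁻ t in Set.Icc (0 : ℝ) 1, ({1} : Set ℝ).indicator 1 t ∂μ)) := by
    refine tendsto_lintegral_filter_of_dominated_convergence (fun _ => 1)
      (.of_forall fun x => (measurable_harmKernel x).div_const _) ?_ (by simp) ?_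
    · filter_upwards [eventually_ge_atTop 1] with x hx
      filter_upwards [ae_restrict_mem measurableSet_Icc] with t ht
      exact harmKernel_div_le_one ht hx
    · filter_upwards [ae_restrict_mem measurableSet_Icc] with t ht
      exact tendsto_harmKernel_div_atTop ht
  have hmass : ∫⁻ t in Set.Icc (0 : ℝ) 1, ({1} : Set ℝ).indicator 1 t ∂μ = μ {1} := by
    rw [lintegral_indicator_one (measurableSet_singleton 1),
      Measure.restrict_apply (measurableSet_singleton 1), Set.inter_eq_left.2 (by simp)]
  rw [hmass] at hlim
  rw [← ENNReal.tendsto_coe, ENNReal.coe_toNNReal (measure_ne_top μ _)]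
  refine hlim.congr' ((eventually_ne_atTop 0).mono fun x hx => ?_)
  beta_reduce
  rw [ENNReal.coe_div hx, hμ.2 x]
  simp only [div_eq_mul_inv]
  exact lintegral_mul_const _ (measurable_harmKernel x)

/-- For an operator monotone function `f` with associated measure `μ`,
`lim_{x→0⁺} x·f(1/x) = lim_{x→∞} f(x)/x = μ({1})`; hence a transpose `g` of `f`
satisfies `g(0) = 0` iff `μ({1}) = 0`. -/
theorem transpose_value_at_zero (f : ℝ≥0 → ℝ≥0) (hf : OperatorMonotone f)
    (μ : Measure ℝ) [IsFiniteMeasure μ] (hμ : IsAssociatedMeasure f μ) :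
    Tendsto (fun x : ℝ≥0 => x * f x⁻¹) (𝓝[>] (0 : ℝ≥0)) (𝓝 (μ {(1 : ℝ)}).toNNReal) ∧
    Tendsto (fun x : ℝ≥0 => f x / x) atTop (𝓝 (μ {(1 : ℝ)}).toNNReal) ∧
    ∀ g : ℝ≥0 → ℝ≥0, IsTransposeFunction g f → (g 0 = 0 ↔ μ {(1 : ℝ)} = 0) := by
  have htop := hμ.tendsto_div_atTop
  have hzero : Tendsto (fun x : ℝ≥0 => x * f x⁻¹) (𝓝[>] (0 : ℝ≥0))
      (𝓝 (μ {(1 : ℝ)}).toNNReal) := by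
    refine (htop.comp tendsto_inv_nhdsGT_zero).congr fun x => ?_
    simp [div_eq_mul_inv, mul_comm]
  refine ⟨hzero, htop, fun g hg => ?_⟩
  rw [tendsto_nhds_unique hg.2 hzero, ENNReal.toNNReal_eq_zero_iff]
  simp

end
end

section
/- Let σ be a mean (an operator connection with I σ I = I) with representing function f. Then f(0) = 0 if and only if I σ P = P for every orthogonal projection P on H. -/
open ContinuousLinearMap Filter Topology MeasureTheory
open scoped NNReal ENNReal

set_option synthInstance.maxHeartbeats 1000000
set_option maxHeartbeats 1000000

noncomputable section

variable {H : Type} [NormedAddCommGroup H] [InnerProductSpace ℂ H] [CompleteSpace H]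

theorem mul_eq_zero_of_conj_nonpos {D C : H →L[ℂ] H} (hD : 0 ≤ D) (hC : IsSelfAdjoint C)
    (h : C * D * C ≤ 0) : D * C = 0 := by
  obtain ⟨b, rfl⟩ := CStarAlgebra.nonneg_iff_eq_star_mul_self.mp hD
  have e : C * (star b * b) * C = star (b * C) * (b * C) := by
    rw [star_mul, hC.star_eq]
    simp only [mul_assoc]
  have h0 : star (b * C) * (b * C) = 0 := le_antisymm (e ▸ h) (star_mul_self_nonneg _)
  rw [mul_assoc, (CStarRing.star_mul_self_eq_zero_iff _).mp h0, mul_zero]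

/-- A mean `σ` with representing function `f` satisfies `f(0) = 0`
iff `I σ P = P` for every orthogonal projection `P`. -/
theorem mean_nonregular_iff_fixes_projections [Nontrivial H]
    (σ : (H →L[ℂ] H) → (H →L[ℂ] H) → (H →L[ℂ] H)) (hσ : IsConnection σ)
    (hmean : σ 1 1 = 1) (f : ℝ≥0 → ℝ≥0) (hf : IsRepresentingFunction σ f) :
    f 0 = 0 ↔
      ∀ P : H →L[ℂ] H, IsSelfAdjoint P → IsIdempotentElem P → σ 1 P = P := by
  have pos0 : (0 : H →L[ℂ] H).IsPositive := (nonneg_iff_isPositive _).mp le_rfl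
  have pos1 : (1 : H →L[ℂ] H).IsPositive := (nonneg_iff_isPositive _).mp zero_le_one
  have hσ0 : σ 1 0 = (f 0 : ℝ) • (1 : H →L[ℂ] H) := by simpa using hf.2 0
  constructor
  · intro h0 P hP hPP
    rw [h0, NNReal.coe_zero, zero_smul] at hσ0
    have hproj : IsStarProjection P := ⟨hPP, hP⟩
    have hQ : IsStarProjection (1 - P) := hproj.one_sub
    have posP := (nonneg_iff_isPositive _).mp hproj.nonneg
    have posQ := (nonneg_iff_isPositive _).mp hQ.nonneg
    have hPS : P ≤ σ 1 P := by
      have h1 := hσ.transformer 1 1 P pos1 pos1 posP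
      rw [hmean, mul_one, hPP.eq] at h1
      exact h1.trans (hσ.mono _ _ _ _ posP posP pos1 posP hproj.le_one le_rfl)
    have hS1 : σ 1 P ≤ 1 :=
      (hσ.mono _ _ _ _ pos1 posP pos1 pos1 le_rfl hproj.le_one).trans_eq hmean
    have hQP : (1 - P) * P = 0 := by rw [sub_mul, one_mul, hPP.eq, sub_self]
    have hQSQ : (1 - P) * σ 1 P * (1 - P) ≤ 0 := by
      have h1 := hσ.transformer 1 P (1 - P) pos1 posP posQ
      rw [hQP, zero_mul, mul_one, hQ.isIdempotentElem.eq] at h1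
      exact h1.trans ((hσ.mono _ _ _ _ posQ pos0 pos1 pos0 hQ.le_one le_rfl).trans_eq hσ0)
    have hPSP : P * σ 1 P * P ≤ P := by
      have h1 := hP.conjugate_le_conjugate hS1
      rwa [mul_one, hPP.eq] at h1
    have hDQ : (σ 1 P - P) * (1 - P) = 0 := by
      refine mul_eq_zero_of_conj_nonpos (sub_nonneg.mpr hPS) hQ.isSelfAdjoint ?_
      rwa [mul_sub (1 - P) (σ 1 P), hQP, sub_zero]
    have hDP : (σ 1 P - P) * P = 0 := by
      refine mul_eq_zero_of_conj_nonpos (sub_nonneg.mpr hPS) hP ?_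
      rwa [mul_sub, hPP.eq, sub_mul, hPP.eq, sub_nonpos]
    rw [mul_sub, mul_one, hDP, sub_zero] at hDQ
    exact sub_eq_zero.mp hDQ
  · intro h
    rw [h 0 (IsSelfAdjoint.zero _) IsIdempotentElem.zero] at hσ0
    exact_mod_cast (smul_eq_zero.mp hσ0.symm).resolve_right one_ne_zero

end
end
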